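/- Correctness of the alternating fixpoint procedure (false part): let P be a ground program over a type α of atoms and let j ≥ 0 be an index at which the alternating fixpoint sequence is stationary, i.e. K_j = K_{j+1} and U_j = U_{j+1}. Then the second component of the well-founded partial model equals the complement of U_j: (lfp W_P).2 = αᶜ-complement of U_j, i.e. a ground atom is false in the well-founded model of P if and only if it does not belong to U_j. -/

import Mathlib

/-- A ground rule: head atom, finite set of positive subgoals, finite set of negative subgoals. -/
structure GroundRule (α : Type*) where
  head : α
  pos : Finset α
  neg : Finset α

/-- The extended immediate consequence operator `T_{P,J}(I)`. -/
def Tstep {α : Type*} (P : Set (GroundRule α)) (J I : Set α) : Set α :=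
  {a | ∃ r ∈ P, r.head = a ∧ ↑r.pos ⊆ I ∧ (↑r.neg ∩ J : Set α) = ∅}

lemma Tstep_mono {α : Type*} (P : Set (GroundRule α)) (J : Set α) : Monotone (Tstep P J) := by
  rintro I I' h a ⟨r, hr, hh, hpos, hneg⟩
  exact ⟨r, hr, hh, hpos.trans h, hneg⟩

/-- `T_{P,J}` bundled as a monotone map on the complete lattice of subsets of `α`. -/
def TstepHom {α : Type*} (P : Set (GroundRule α)) (J : Set α) : Set α →o Set α :=
  ⟨Tstep P J, Tstep_mono P J⟩

/-- The least fixed point of `I ↦ T_{P,J}(I)` (Knaster–Tarski). -/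
def Tlfp {α : Type*} (P : Set (GroundRule α)) (J : Set α) : Set α :=
  OrderHom.lfp (TstepHom P J)

/-- The definite part `P⁺` of `P`: the rules with no negative subgoals. -/
def definitePart {α : Type*} (P : Set (GroundRule α)) : Set (GroundRule α) :=
  {r ∈ P | r.neg = ∅}

/-- The alternating fixpoint sequence `(K_i, U_i)`:
`K₀ := lfp (T_{P⁺,∅})`, `U₀ := lfp (T_{P,K₀})`, and for `i > 0`,
`K_i := lfp (T_{P,U_{i-1}})`, `U_i := lfp (T_{P,K_i})`. -/
def AFP {α : Type*} (P : Set (GroundRule α)) : ℕ → Set α × Set α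
  | 0 => (Tlfp (definitePart P) ∅, Tlfp P (Tlfp (definitePart P) ∅))
  | i + 1 => (Tlfp P (AFP P i).2, Tlfp P (Tlfp P (AFP P i).2))

/-- The true (known) sets `K_i` of the alternating fixpoint procedure. -/
def Kseq {α : Type*} (P : Set (GroundRule α)) (i : ℕ) : Set α := (AFP P i).1

/-- The possible (unknown) sets `U_i` of the alternating fixpoint procedure. -/
def Useq {α : Type*} (P : Set (GroundRule α)) (i : ℕ) : Set α := (AFP P i).2

/-- A set `A` of atoms is unfounded with respect to the partial interpretation `(Tset, Fset)`
if every rule of `P` whose head lies in `A` has a positive subgoal in `Fset`, or a negative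
subgoal in `Tset`, or a positive subgoal in `A`. -/
def Unfounded {α : Type*} (P : Set (GroundRule α)) (Tset Fset A : Set α) : Prop :=
  ∀ r ∈ P, r.head ∈ A →
    (∃ b ∈ r.pos, b ∈ Fset) ∨ (∃ b ∈ r.neg, b ∈ Tset) ∨ (∃ b ∈ r.pos, b ∈ A)

/-- The greatest unfounded set `U_P(T,F)`: the union of all unfounded sets w.r.t. `(Tset, Fset)`. -/
def UP {α : Type*} (P : Set (GroundRule α)) (Tset Fset : Set α) : Set α :=
  ⋃₀ {A | Unfounded P Tset Fset A}

lemma Unfounded.mono {α : Type*} {P : Set (GroundRule α)} {T T' F F' A : Set α}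
    (hT : T ⊆ T') (hF : F ⊆ F') (h : Unfounded P T F A) : Unfounded P T' F' A := by
  intro r hr hh
  rcases h r hr hh with ⟨b, hb, hbF⟩ | ⟨b, hb, hbT⟩ | h3
  · exact Or.inl ⟨b, hb, hF hbF⟩
  · exact Or.inr (Or.inl ⟨b, hb, hT hbT⟩)
  · exact Or.inr (Or.inr h3)

/-- The operator `W_P(T,F) := ({a | some rule with head a has pos ⊆ T and neg ⊆ F}, U_P(T,F))`
on pairs of sets of atoms. -/
def WP {α : Type*} (P : Set (GroundRule α)) : Set α × Set α → Set α × Set α :=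
  fun TF =>
    ({a | ∃ r ∈ P, r.head = a ∧ ↑r.pos ⊆ TF.1 ∧ ↑r.neg ⊆ TF.2}, UP P TF.1 TF.2)

lemma WP_mono {α : Type*} (P : Set (GroundRule α)) : Monotone (WP P) := by
  intro p q hpq
  refine ⟨?_, ?_⟩
  · intro a ha
    obtain ⟨r, hr, hh, hpos, hneg⟩ := ha
    exact ⟨r, hr, hh, fun x hx => hpq.1 (hpos hx), fun x hx => hpq.2 (hneg hx)⟩
  · intro a ha
    obtain ⟨A, hA, haA⟩ := ha
    exact ⟨A, hA.mono hpq.1 hpq.2, haA⟩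

/-- `W_P` bundled as a monotone map; its least fixed point `lfp W_P` is the
well-founded partial model of `P` (true atoms, false atoms). -/
def WPHom {α : Type*} (P : Set (GroundRule α)) : Set α × Set α →o Set α × Set α :=
  ⟨WP P, WP_mono P⟩

lemma Tstep_Tlfp {α : Type*} (P : Set (GroundRule α)) (J : Set α) :
    Tstep P J (Tlfp P J) = Tlfp P J :=
  (TstepHom P J).map_lfp

lemma Tlfp_subset {α : Type*} {P : Set (GroundRule α)} {J I : Set α} (h : Tstep P J I ⊆ I) :
    Tlfp P J ⊆ I :=
  (TstepHom P J).lfp_le h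

lemma WP_lfp {α : Type*} (P : Set (GroundRule α)) :
    WP P (OrderHom.lfp (WPHom P)) = OrderHom.lfp (WPHom P) :=
  (WPHom P).map_lfp

lemma Useq_eq_Tlfp_Kseq {α : Type*} (P : Set (GroundRule α)) (i : ℕ) :
    Useq P i = Tlfp P (Kseq P i) := by
  cases i <;> rfl

/-- Any set unfounded with respect to `(K, Uᶜ)` is disjoint from `U = lfp T_{P,K}`. -/
lemma UP_subset_compl_Tlfp {α : Type*} (P : Set (GroundRule α)) (K : Set α) :
    UP P K (Tlfp P K)ᶜ ⊆ (Tlfp P K)ᶜ := by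
  rintro a ⟨A, hA, haA⟩ haU
  have hsub : Tlfp P K ⊆ Tlfp P K \ A := by
    apply Tlfp_subset
    rintro _ ⟨r, hr, rfl, hpos, hneg⟩
    refine ⟨?_, fun hh => ?_⟩
    · rw [← Tstep_Tlfp]
      exact ⟨r, hr, rfl, fun x hx => (hpos hx).1, hneg⟩
    · rcases hA r hr hh with ⟨b, hb, hbF⟩ | ⟨b, hb, hbK⟩ | ⟨b, hb, hbA⟩
      · exact hbF (hpos hb).1
      · exact Set.eq_empty_iff_forall_notMem.1 hneg b ⟨hb, hbK⟩
      · exact (hpos hb).2 hbA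
  exact (hsub haU).2 haA

/-- If `K ⊆ T`, then the complement of `lfp T_{P,K}` is unfounded with respect to `(T, F)`. -/
lemma unfounded_compl_Tlfp {α : Type*} (P : Set (GroundRule α)) {K T : Set α} (F : Set α)
    (hKT : K ⊆ T) : Unfounded P T F (Tlfp P K)ᶜ := by
  intro r hr hh
  by_contra! hcon
  obtain ⟨-, hneg, hpos⟩ := hcon
  apply hh
  rw [← Tstep_Tlfp]
  refine ⟨r, hr, rfl, fun x hx => not_not.1 (hpos x hx), ?_⟩
  exact Set.eq_empty_iff_forall_notMem.2 fun x hx => hneg x hx.1 (hKT hx.2)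

lemma compl_Tlfp_subset_lfp_WP {α : Type*} (P : Set (GroundRule α)) {K : Set α}
    (hK : K ⊆ (OrderHom.lfp (WPHom P)).1) : (Tlfp P K)ᶜ ⊆ (OrderHom.lfp (WPHom P)).2 := by
  intro a ha
  rw [← WP_lfp]
  exact ⟨_, unfounded_compl_Tlfp P _ hK, ha⟩

lemma Tlfp_subset_lfp_WP {α : Type*} (P : Set (GroundRule α)) {U : Set α}
    (hU : Uᶜ ⊆ (OrderHom.lfp (WPHom P)).2) : Tlfp P U ⊆ (OrderHom.lfp (WPHom P)).1 := by
  apply Tlfp_subset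
  rintro _ ⟨r, hr, rfl, hpos, hneg⟩
  rw [← WP_lfp]
  exact ⟨r, hr, rfl, hpos,
    fun x hx => hU fun hxU => Set.eq_empty_iff_forall_notMem.1 hneg x ⟨hx, hxU⟩⟩

lemma Tlfp_definitePart_subset_lfp_WP {α : Type*} (P : Set (GroundRule α)) :
    Tlfp (definitePart P) ∅ ⊆ (OrderHom.lfp (WPHom P)).1 := by
  apply Tlfp_subset
  rintro _ ⟨r, ⟨hr, hneg⟩, rfl, hpos, -⟩
  rw [← WP_lfp]
  exact ⟨r, hr, rfl, hpos, by simp [hneg]⟩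

lemma Kseq_subset_lfp_WP {α : Type*} (P : Set (GroundRule α)) (i : ℕ) :
    Kseq P i ⊆ (OrderHom.lfp (WPHom P)).1 := by
  induction i with
  | zero => exact Tlfp_definitePart_subset_lfp_WP P
  | succ i ih =>
    refine Tlfp_subset_lfp_WP P (U := Useq P i) ?_
    rw [Useq_eq_Tlfp_Kseq]
    exact compl_Tlfp_subset_lfp_WP P ih

/-- Correctness of the alternating fixpoint procedure (false part): if the alternating
fixpoint sequence is stationary at index `j`, then the set of false atoms of the
well-founded partial model `lfp W_P` is the complement of `U_j`. -/
theorem AFP_correct_false {α : Type*} (P : Set (GroundRule α)) (j : ℕ)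
    (hK : Kseq P j = Kseq P (j + 1)) (hU : Useq P j = Useq P (j + 1)) :
    (OrderHom.lfp (WPHom P)).2 = (Useq P j)ᶜ := by
  have hKU : Tlfp P (Useq P j) = Kseq P j := hK.symm
  have hUK := Useq_eq_Tlfp_Kseq P j
  apply Set.Subset.antisymm
  · have hle : OrderHom.lfp (WPHom P) ≤ (Kseq P j, (Useq P j)ᶜ) := by
      refine (WPHom P).lfp_le ⟨?_, ?_⟩
      · rintro _ ⟨r, hr, rfl, hpos, hneg⟩
        change r.head ∈ Kseq P j
        rw [← hKU, ← Tstep_Tlfp, hKU]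
        exact ⟨r, hr, rfl, hpos,
          Set.eq_empty_iff_forall_notMem.2 fun x hx => hneg hx.1 hx.2⟩
      · change UP P (Kseq P j) (Useq P j)ᶜ ⊆ (Useq P j)ᶜ
        rw [hUK]
        exact UP_subset_compl_Tlfp P (Kseq P j)
    exact hle.2
  · rw [hUK]
    exact compl_Tlfp_subset_lfp_WP P (Kseq_subset_lfp_WP P j)
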